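/- Let p ≥ 2 be an integer and c ∈ ℂ⁴ with componentwise ring operations, and f_c(η) = η^p + c. Then the tricomplex filled-in Julia set K_{3,c}^p = {η ∈ ℂ⁴ : (f_c^m(η))_{m≥1} is bounded} is a compact subset of ℂ⁴, and it is a connected set if and only if 0 ∈ K_{3,c}^p. -/

import Mathlib

open Set Filter Topology Metric

section Connectedness

variable {X Y : Type*} [TopologicalSpace X] [TopologicalSpace Y]

/-- If an open and closed map has a one-point fibre over some point of a preconnected set,
then the preimage of that set is preconnected. -/
theorem IsPreconnected.preimage_of_isOpenMap_of_isClosedMap {f : X → Y} (ho : IsOpenMap f)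
    (hc : IsClosedMap f) {A : Set Y} (hA : IsPreconnected A) {x : X} (hx : f x ∈ A)
    (hfib : ∀ y, f y = f x → y = x) : IsPreconnected (f ⁻¹' A) := by
  have key : ∀ u v : Set X, IsOpen u → IsOpen v → f ⁻¹' A ⊆ u ∪ v → x ∈ u →
      (f ⁻¹' A ∩ v).Nonempty → (f ⁻¹' A ∩ (u ∩ v)).Nonempty := by
    rintro u v hu hv huv hxu ⟨y, hyA, hyv⟩
    obtain ⟨a, haA, ⟨w, hwv, rfl⟩, ha⟩ := hA (f '' v) (f '' uᶜ)ᶜ (ho v hv)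
      (hc _ hu.isClosed_compl).isOpen_compl
      (by
        intro a ha
        by_cases h : a ∈ f '' uᶜ
        · obtain ⟨w, hw, rfl⟩ := h
          exact Or.inl ⟨w, (huv ha).resolve_left hw, rfl⟩
        · exact Or.inr h)
      ⟨f y, hyA, y, hyv, rfl⟩
      ⟨f x, hx, by rintro ⟨w, hw, hwx⟩; exact hw (hfib w hwx ▸ hxu)⟩
    refine ⟨w, haA, ?_, hwv⟩
    by_contra hw
    exact ha ⟨w, hw, rfl⟩
  intro u v hu hv huv hnu hnv
  rcases huv (show x ∈ f ⁻¹' A from hx) with h | h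
  · exact key u v hu hv huv h hnv
  · rw [inter_comm u v]
    exact key v u hv hu (union_comm u v ▸ huv) h hnu

/-- A directed intersection of compact preconnected subsets of a Hausdorff space is
preconnected. -/
theorem isPreconnected_iInter_of_directed [T2Space X] {ι : Type*} [Nonempty ι] {V : ι → Set X}
    (hd : Directed (· ⊇ ·) V) (hV : ∀ i, IsCompact (V i)) (hp : ∀ i, IsPreconnected (V i)) :
    IsPreconnected (⋂ i, V i) := by
  have hK : IsCompact (⋂ i, V i) :=
    (hV (Classical.arbitrary ι)).of_isClosed_subset (isClosed_iInter fun i => (hV i).isClosed)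
      (iInter_subset _ _)
  intro u v hu hv huv hnu hnv
  by_contra hne
  have hdisj : ∀ z ∈ ⋂ i, V i, z ∈ u → z ∉ v := fun z hz h h' => hne ⟨z, hz, h, h'⟩
  obtain ⟨U, W, hU, hW, hKU, hKW, hUW⟩ := SeparatedNhds.of_isCompact_isCompact
    (hK.diff hv) (hK.diff hu) (disjoint_left.2 fun z hz hz' =>
      (huv hz.1).elim hz'.2 hz.2)
  obtain ⟨i, hi⟩ := exists_subset_nhds_of_isCompact hd hV (U := U ∪ W) fun z hz => by
    refine (hU.union hW).mem_nhds ?_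
    by_cases h : z ∈ v
    · exact Or.inr (hKW ⟨hz, fun h' => hdisj z hz h' h⟩)
    · exact Or.inl (hKU ⟨hz, h⟩)
  obtain ⟨a, ha, hau⟩ := hnu
  obtain ⟨b, hb, hbv⟩ := hnv
  obtain ⟨w, -, hwU, hwW⟩ := hp i U W hU hW hi
    ⟨a, mem_iInter.1 ha i, hKU ⟨ha, hdisj a ha hau⟩⟩
    ⟨b, mem_iInter.1 hb i, hKW ⟨hb, fun h => hdisj b hb h hbv⟩⟩
  exact disjoint_left.1 hUW hwU hwW

end Connectedness

section Roots

/-- `z - a` has a continuous `p`-th root on `K`. -/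
def HasContinuousRootOn (p : ℕ) (K : Set ℂ) (a : ℂ) : Prop :=
  ∃ g : ℂ → ℂ, ContinuousOn g K ∧ ∀ z ∈ K, g z ^ p = z - a

theorem exists_continuousOn_pow_eq_one_sub {p : ℕ} (hp : p ≠ 0) {K : Set ℂ} {u : ℂ → ℂ}
    (hu : ContinuousOn u K) (hlt : ∀ z ∈ K, ‖u z‖ < 1) :
    ∃ g : ℂ → ℂ, ContinuousOn g K ∧ ∀ z ∈ K, g z ^ p = 1 - u z ∧ g z ≠ 0 := by
  have hslit : ∀ z ∈ K, 1 - u z ∈ Complex.slitPlane := fun z hz => by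
    refine Or.inl ?_
    have := (Complex.re_le_norm (u z)).trans_lt (hlt z hz)
    simpa using this
  refine ⟨fun z => (1 - u z) ^ ((p : ℂ)⁻¹), ?_, fun z hz => ?_⟩
  · exact (continuousOn_const.sub hu).cpow continuousOn_const hslit
  · have h : ((1 - u z) ^ ((p : ℂ)⁻¹)) ^ p = 1 - u z := Complex.cpow_nat_inv_pow _ hp
    refine ⟨h, fun h0 => Complex.slitPlane_ne_zero (hslit z hz) ?_⟩
    rw [← h]
    simp only at h0
    rw [h0, zero_pow hp]

theorem HasContinuousRootOn.of_norm_lt {p : ℕ} (hp : p ≠ 0) {K : Set ℂ} {a : ℂ}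
    (ha : ∀ z ∈ K, ‖z‖ < ‖a‖) : HasContinuousRootOn p K a := by
  obtain ⟨g, hg, hgp⟩ := exists_continuousOn_pow_eq_one_sub hp (K := K) (u := fun z => z / a)
    (by fun_prop) fun z hz => by
      have h := ha z hz
      rw [norm_div, div_lt_one ((norm_nonneg z).trans_lt h)]
      exact h
  refine ⟨fun z => (-a) ^ ((p : ℂ)⁻¹) * g z, continuousOn_const.mul hg, fun z hz => ?_⟩
  have ha0 : a ≠ 0 := norm_pos_iff.1 ((norm_nonneg z).trans_lt (ha z hz))
  rw [mul_pow, Complex.cpow_nat_inv_pow _ hp, (hgp z hz).1]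
  field_simp
  ring

theorem hasContinuousRootOn_iff_of_ball_subset {p : ℕ} (hp : p ≠ 0) {K : Set ℂ} {a b : ℂ} {r : ℝ}
    (hr : ball a r ⊆ Kᶜ) (hb : b ∈ ball a r) :
    HasContinuousRootOn p K b ↔ HasContinuousRootOn p K a := by
  have hdist : ∀ z ∈ K, r ≤ ‖z - a‖ := fun z hz => by
    by_contra! h
    exact hr (mem_ball_iff_norm.2 h) hz
  have hr0 : 0 < r := pos_of_mem_ball hb
  have hne : ∀ z ∈ K, z - a ≠ 0 := fun z hz => norm_pos_iff.1 (hr0.trans_le (hdist z hz))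
  obtain ⟨g, hg, hgp⟩ := exists_continuousOn_pow_eq_one_sub hp (K := K)
    (u := fun z => (b - a) / (z - a))
    (continuousOn_const.div (by fun_prop) hne) fun z hz => by
      rw [norm_div, div_lt_one (norm_pos_iff.2 (hne z hz))]
      exact (mem_ball_iff_norm.1 hb).trans_le (hdist z hz)
  have hmul : ∀ z ∈ K, g z ^ p * (z - a) = z - b := fun z hz => by
    have := hne z hz
    rw [(hgp z hz).1]
    field_simp
    ring
  constructor
  · rintro ⟨k, hk, hkp⟩
    refine ⟨fun z => k z / g z, hk.div hg fun z hz => (hgp z hz).2, fun z hz => ?_⟩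
    rw [div_pow, hkp z hz, ← hmul z hz,
      mul_div_cancel_left₀ _ (pow_ne_zero p (hgp z hz).2)]
  · rintro ⟨k, hk, hkp⟩
    refine ⟨fun z => g z * k z, hg.mul hk, fun z hz => ?_⟩
    rw [mul_pow, hkp z hz, hmul z hz]

/-- If every nonempty bounded open set disjoint from the compact set `K` has a frontier point
outside `K`, that is, if `Kᶜ` has no bounded component, then `z - a` has a continuous `p`-th root
on `K` for each `a ∉ K`. -/
theorem hasContinuousRootOn_of_notMem {p : ℕ} (hp : p ≠ 0) {K : Set ℂ} (hK : IsCompact K)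
    (hfull : ∀ T : Set ℂ, IsOpen T → Bornology.IsBounded T → Disjoint T K → frontier T ⊆ K →
      T = ∅) {a : ℂ} (ha : a ∉ K) : HasContinuousRootOn p K a := by
  have hball : ∀ b ∉ K, ∃ r > 0, ball b r ⊆ Kᶜ := fun b hb =>
    Metric.isOpen_iff.1 hK.isClosed.isOpen_compl b hb
  set T : Set ℂ := {b | b ∉ K ∧ ¬ HasContinuousRootOn p K b}
  have hTo : IsOpen T := by
    refine Metric.isOpen_iff.2 fun b hb => ?_
    obtain ⟨r, hr, hbr⟩ := hball b hb.1
    exact ⟨r, hr, fun w hw =>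
      ⟨hbr hw, fun h => hb.2 ((hasContinuousRootOn_iff_of_ball_subset hp hbr hw).1 h)⟩⟩
  have hTb : Bornology.IsBounded T := by
    obtain ⟨R, hR⟩ := hK.isBounded.exists_norm_le
    refine isBounded_iff_forall_norm_le.2 ⟨R, fun b hb => ?_⟩
    by_contra! h
    exact hb.2 (.of_norm_lt hp fun z hz => (hR z hz).trans_lt h)
  have hTK : Disjoint T K := disjoint_left.2 fun b hb => hb.1
  have hfr : frontier T ⊆ K := by
    intro b hb
    by_contra hbK
    rw [hTo.frontier_eq] at hb
    obtain ⟨r, hr, hbr⟩ := hball b hbK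
    obtain ⟨w, hwT, hw⟩ := Metric.mem_closure_iff.1 hb.1 r hr
    rw [dist_comm] at hw
    exact hb.2 ⟨hbK, fun h =>
      hwT.2 ((hasContinuousRootOn_iff_of_ball_subset hp hbr hw).2 h)⟩
  by_contra h
  have : a ∈ T := ⟨ha, h⟩
  rw [hfull T hTo hTb hTK hfr] at this
  exact this

end Roots

section FilledJulia

/-- The map `z ↦ z ^ p + c` of the complex plane. -/
noncomputable def powAdd (p : ℕ) (c z : ℂ) : ℂ := z ^ p + c

/-- The filled-in Julia set of `z ↦ z ^ p + c` in the complex plane. -/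
def filledJulia (p : ℕ) (c : ℂ) : Set ℂ :=
  {z | Bornology.IsBounded (range fun m : ℕ => (powAdd p c)^[m] z)}

/-- The set of points whose `n`-th iterate under `z ↦ z ^ p + c` has norm at most `‖c‖ + 2`. -/
def escapeLevel (p : ℕ) (c : ℂ) (n : ℕ) : Set ℂ :=
  {z | ‖(powAdd p c)^[n] z‖ ≤ ‖c‖ + 2}

variable {p : ℕ} {c : ℂ}

theorem differentiable_powAdd : Differentiable ℂ (powAdd p c) := by
  unfold powAdd
  fun_prop

theorem differentiable_iterate_powAdd (n : ℕ) : Differentiable ℂ (powAdd p c)^[n] :=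
  differentiable_powAdd.iterate n

theorem two_mul_norm_le_norm_powAdd (hp : 2 ≤ p) {z : ℂ} (hz : ‖c‖ + 2 ≤ ‖z‖) :
    2 * ‖z‖ ≤ ‖powAdd p c z‖ := by
  have hc := norm_nonneg c
  have h1 : ‖z‖ ^ 2 ≤ ‖z‖ ^ p := pow_le_pow_right₀ (by linarith) hp
  have h2 : ‖z‖ ^ p - ‖c‖ ≤ ‖powAdd p c z‖ := by
    have := norm_sub_le_norm_add (z ^ p) c
    rwa [norm_pow] at this
  nlinarith

theorem escapeLevel_succ_subset (hp : 2 ≤ p) (n : ℕ) :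
    escapeLevel p c (n + 1) ⊆ escapeLevel p c n := by
  intro z hz
  simp only [escapeLevel, mem_ofPred_eq, Function.iterate_succ_apply'] at hz ⊢
  by_contra! h
  linarith [two_mul_norm_le_norm_powAdd hp h.le, norm_nonneg c]

theorem antitone_escapeLevel (hp : 2 ≤ p) : Antitone (escapeLevel p c) :=
  antitone_nat_of_succ_le (escapeLevel_succ_subset hp)

theorem filledJulia_eq_iInter (hp : 2 ≤ p) : filledJulia p c = ⋂ n, escapeLevel p c n := by
  ext z
  simp only [filledJulia, mem_ofPred_eq, mem_iInter]
  constructor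
  · intro hb n
    by_contra hn
    have hgrow : ∀ k : ℕ, ‖c‖ + 2 ≤ ‖(powAdd p c)^[n + k] z‖ ∧
        (2 : ℝ) ^ k ≤ ‖(powAdd p c)^[n + k] z‖ := by
      intro k
      induction k with
      | zero =>
        simp only [escapeLevel, mem_ofPred_eq, not_le] at hn
        refine ⟨hn.le, ?_⟩
        have := norm_nonneg c
        simp only [add_zero, pow_zero]
        linarith
      | succ k ih =>
        rw [← add_assoc, Function.iterate_succ_apply', pow_succ]
        have := two_mul_norm_le_norm_powAdd hp ih.1
        have := norm_nonneg c
        constructor <;> linarith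
    obtain ⟨M, hM⟩ := hb.exists_norm_le
    obtain ⟨k, hk⟩ := pow_unbounded_of_one_lt M (one_lt_two : (1 : ℝ) < 2)
    exact (hk.trans_le (hgrow k).2).not_ge (hM _ ⟨n + k, rfl⟩)
  · intro h
    refine isBounded_iff_forall_norm_le.2 ⟨‖c‖ + 2, ?_⟩
    rintro _ ⟨n, rfl⟩
    exact h n

theorem escapeLevel_zero : escapeLevel p c 0 = closedBall 0 (‖c‖ + 2) := by
  ext z
  simp [escapeLevel]

theorem escapeLevel_succ (n : ℕ) : escapeLevel p c (n + 1) = powAdd p c ⁻¹' escapeLevel p c n := by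
  ext z
  simp [escapeLevel]

theorem isCompact_escapeLevel (hp : 2 ≤ p) (n : ℕ) : IsCompact (escapeLevel p c n) := by
  refine IsCompact.of_isClosed_subset (isCompact_closedBall (0 : ℂ) (‖c‖ + 2))
    (isClosed_le (differentiable_iterate_powAdd n).continuous.norm continuous_const) ?_
  rw [← escapeLevel_zero (p := p)]
  exact antitone_escapeLevel hp (Nat.zero_le n)

theorem isCompact_filledJulia (hp : 2 ≤ p) : IsCompact (filledJulia p c) := by
  rw [filledJulia_eq_iInter hp]
  exact (isCompact_escapeLevel hp 0).of_isClosed_subset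
    (isClosed_iInter fun n => (isCompact_escapeLevel hp n).isClosed) (iInter_subset _ 0)

theorem powAdd_mem_filledJulia_iff (hp : 2 ≤ p) {z : ℂ} :
    powAdd p c z ∈ filledJulia p c ↔ z ∈ filledJulia p c := by
  simp only [filledJulia_eq_iInter hp, mem_iInter]
  refine ⟨fun h n => escapeLevel_succ_subset hp n ?_, fun h n => ?_⟩
  · rw [escapeLevel_succ]
    exact h n
  · have := h (n + 1)
    rwa [escapeLevel_succ] at this

theorem nonempty_filledJulia (hp : 2 ≤ p) : (filledJulia p c).Nonempty := by
  rw [filledJulia_eq_iInter hp]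
  have hsurj : Function.Surjective (powAdd p c) := fun w => by
    obtain ⟨z, hz⟩ := IsAlgClosed.exists_pow_nat_eq (w - c) (by omega : 0 < p)
    exact ⟨z, by simp [powAdd, hz]⟩
  refine IsCompact.nonempty_iInter_of_sequence_nonempty_isCompact_isClosed _
    (escapeLevel_succ_subset hp) (fun n => ?_) (isCompact_escapeLevel hp 0)
    fun n => (isCompact_escapeLevel hp n).isClosed
  obtain ⟨z, hz⟩ := hsurj.iterate n 0
  exact ⟨z, by simp only [escapeLevel, mem_ofPred_eq, hz, norm_zero]; positivity⟩

theorem isOpenMap_powAdd (hp : p ≠ 0) : IsOpenMap (powAdd p c) :=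
  have : NeZero p := ⟨hp⟩
  (isOpenMap_add_right c).comp (Complex.isOpenQuotientMap_pow p).isOpenMap

theorem isClosedMap_powAdd : IsClosedMap (powAdd p c) :=
  (isClosedMap_add_right c).comp (isClosedMap_pow ℂ p)

theorem isConnected_filledJulia_of_zero_mem (hp : 2 ≤ p) (h0 : (0 : ℂ) ∈ filledJulia p c) :
    IsConnected (filledJulia p c) := by
  refine ⟨⟨0, h0⟩, ?_⟩
  have hp0 : p ≠ 0 := by omega
  have hc := (powAdd_mem_filledJulia_iff hp).2 h0
  rw [filledJulia_eq_iInter hp] at hc ⊢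
  refine isPreconnected_iInter_of_directed (antitone_escapeLevel hp).directed_ge
    (isCompact_escapeLevel hp) fun n => ?_
  induction n with
  | zero =>
    rw [escapeLevel_zero]
    exact (convex_closedBall _ _).isPreconnected
  | succ n ih =>
    rw [escapeLevel_succ]
    refine ih.preimage_of_isOpenMap_of_isClosedMap (isOpenMap_powAdd hp0) isClosedMap_powAdd
      (mem_iInter.1 hc n) fun y hy => ?_
    simpa [powAdd, hp0] using hy

theorem eq_empty_of_frontier_subset_filledJulia (hp : 2 ≤ p) {T : Set ℂ}
    (hTb : Bornology.IsBounded T) (hd : Disjoint T (filledJulia p c))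
    (hfr : frontier T ⊆ filledJulia p c) : T = ∅ := by
  refine eq_empty_of_forall_notMem fun z hz => disjoint_left.1 hd hz ?_
  rw [filledJulia_eq_iInter hp] at hfr ⊢
  exact mem_iInter.2 fun n => Complex.norm_le_of_forall_mem_frontier_norm_le hTb
    (differentiable_iterate_powAdd n).diffContOnCl (fun w hw => mem_iInter.1 (hfr hw) n)
    (subset_closure hz)

theorem zero_mem_filledJulia_of_isConnected (hp : 2 ≤ p) (hK : IsConnected (filledJulia p c)) :
    (0 : ℂ) ∈ filledJulia p c := by
  by_contra h0
  have hp0 : p ≠ 0 := by omega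
  have hc : c ∉ filledJulia p c := by
    rwa [← powAdd_mem_filledJulia_iff hp, powAdd, zero_pow hp0, zero_add] at h0
  obtain ⟨g, hg, hgp⟩ := hasContinuousRootOn_of_notMem hp0 (isCompact_filledJulia hp)
    (fun T _ hTb hd hfr => eq_empty_of_frontier_subset_filledJulia hp hTb hd hfr) hc
  have hmaps : MapsTo (powAdd p c) (filledJulia p c) (filledJulia p c) :=
    fun z hz => (powAdd_mem_filledJulia_iff hp).2 hz
  have hpow : ∀ z ∈ filledJulia p c, g (powAdd p c z) ^ p = z ^ p := fun z hz => by
    rw [hgp _ (hmaps hz), powAdd, add_sub_cancel_right]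
  have hz0 : ∀ z ∈ filledJulia p c, z ≠ 0 := fun z hz h => h0 (h ▸ hz)
  have hg0 : ∀ z ∈ filledJulia p c, g (powAdd p c z) ≠ 0 := fun z hz h => by
    have := hpow z hz
    rw [h, zero_pow hp0] at this
    exact pow_ne_zero p (hz0 z hz) this.symm
  obtain ⟨z, hz⟩ := hK.nonempty
  obtain ⟨ζ, hζ⟩ : ∃ ζ : ℂ, IsPrimitiveRoot ζ p := ⟨_, Complex.isPrimitiveRoot_exp p hp0⟩
  have hrot : powAdd p c (ζ * z) = powAdd p c z := by
    simp [powAdd, mul_pow, hζ.pow_eq_one]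
  have hζz : ζ * z ∈ filledJulia p c := by
    rw [← powAdd_mem_filledJulia_iff hp, hrot]
    exact hmaps hz
  have hfin : {w : ℂ | w ^ p = 1}.Finite := by
    refine (Polynomial.nthRootsFinset p (1 : ℂ)).finite_toSet.subset fun w hw => ?_
    simpa [Polynomial.mem_nthRootsFinset (Nat.pos_of_ne_zero hp0)] using hw
  have hconst := hK.isPreconnected.constant_of_mapsTo hfin.isDiscrete
    (f := fun z => z / g (powAdd p c z))
    (continuousOn_id.div (hg.comp differentiable_powAdd.continuous.continuousOn hmaps) hg0)
    (fun w hw => by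
      simp only [mem_ofPred_eq, div_pow, hpow w hw]
      exact div_self (pow_ne_zero p (hz0 w hw))) hζz hz
  simp only [hrot] at hconst
  rw [div_left_inj' (hg0 z hz)] at hconst
  exact hζ.ne_one (by omega) (mul_eq_right₀ (hz0 z hz) |>.1 hconst)

theorem isConnected_filledJulia_iff (hp : 2 ≤ p) :
    IsConnected (filledJulia p c) ↔ (0 : ℂ) ∈ filledJulia p c :=
  ⟨zero_mem_filledJulia_of_isConnected hp, isConnected_filledJulia_of_zero_mem hp⟩

theorem setOf_isBounded_range_iterate_eq_pi {ι : Type*} (p : ℕ) (c : ι → ℂ) :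
    {η : ι → ℂ | Bornology.IsBounded
      (range fun m : ℕ => (fun v : ι → ℂ => v ^ p + c)^[m] η)} =
      univ.pi fun i => filledJulia p (c i) := by
  have hiter : ∀ (m : ℕ) (η : ι → ℂ) (i : ι),
      (fun v : ι → ℂ => v ^ p + c)^[m] η i = (powAdd p (c i))^[m] (η i) := by
    intro m
    induction m with
    | zero => intro η i; rfl
    | succ m ih => intro η i; rw [Function.iterate_succ_apply, ih]; rfl
  ext η
  simp only [mem_ofPred_eq, mem_univ_pi, filledJulia, ← Bornology.forall_isBounded_image_eval_iff,
    ← range_comp]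
  refine forall_congr' fun i => ?_
  simp only [Function.comp_def, Function.eval, hiter]

end FilledJulia

/-- The tricomplex filled-in Julia set of `f_c(η) = η^p + c` (with the tricomplex
numbers represented as the product ring `Fin 4 → ℂ`) is a compact subset, and it is
connected if and only if `0` belongs to it. -/
theorem tricomplex_filledJulia_isCompact_and_isConnected_iff
    (p : ℕ) (hp : 2 ≤ p) (c : Fin 4 → ℂ) :
    IsCompact {η : Fin 4 → ℂ | Bornology.IsBounded
        (Set.range fun m : ℕ => (fun v : Fin 4 → ℂ => v ^ p + c)^[m] η)} ∧
      (IsConnected {η : Fin 4 → ℂ | Bornology.IsBounded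
          (Set.range fun m : ℕ => (fun v : Fin 4 → ℂ => v ^ p + c)^[m] η)} ↔
        (0 : Fin 4 → ℂ) ∈ {η : Fin 4 → ℂ | Bornology.IsBounded
          (Set.range fun m : ℕ => (fun v : Fin 4 → ℂ => v ^ p + c)^[m] η)}) := by
  rw [setOf_isBounded_range_iterate_eq_pi, isConnected_univ_pi, mem_univ_pi]
  exact ⟨isCompact_univ_pi fun i => isCompact_filledJulia hp,
    forall_congr' fun i => isConnected_filledJulia_iff hp⟩
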